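/- For every h ∈ ℕ and all indices j, k, the autocovariance admits the spectral representation Σ_{m=0}^∞ (Ψ_{m+h} Σ Ψ_mᵀ)_{j,k} = (1/(2π)) ∫_{-π}^{π} (Ψ̂(ω) Σ Ψ̂(ω)^*)_{j,k} e^{iωh} dω, where the complex integral on the right equals the real number on the left. -/

import Mathlib

open MeasureTheory Matrix

/-- Frequency response `Ψ̂(ω) = ∑_{h=0}^∞ e^{-iωh} Ψ_h`. -/
noncomputable def freqResp {n : ℕ} (Ψ : ℕ → Matrix (Fin n) (Fin n) ℝ) (ω : ℝ) :
    Matrix (Fin n) (Fin n) ℂ :=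
  ∑' h : ℕ, Complex.exp (-(Complex.I * ω * h)) • (Ψ h).map Complex.ofReal

/-- Spectral density `Ψ̂(ω) Σ Ψ̂(ω)^*`. -/
noncomputable def specDens {n : ℕ} (Ψ : ℕ → Matrix (Fin n) (Fin n) ℝ)
    (S : Matrix (Fin n) (Fin n) ℝ) (ω : ℝ) : Matrix (Fin n) (Fin n) ℂ :=
  freqResp Ψ ω * S.map Complex.ofReal * (freqResp Ψ ω)ᴴ

theorem norm_exp_neg_mul_ofReal (x ω : ℝ) (m : ℕ) :
    ‖Complex.exp (-(Complex.I * ω * m)) * (x : ℂ)‖ = |x| := by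
  rw [norm_mul, show -(Complex.I * ω * m) = ((-(ω * m) : ℝ) : ℂ) * Complex.I by push_cast; ring,
    Complex.norm_exp_ofReal_mul_I, one_mul, Complex.norm_real, Real.norm_eq_abs]

theorem summable_exp_neg_mul_ofReal {f : ℕ → ℝ} (hf : Summable fun m => |f m|) (ω : ℝ) :
    Summable fun m : ℕ => ‖Complex.exp (-(Complex.I * ω * m)) * (f m : ℂ)‖ :=
  hf.congr fun m => (norm_exp_neg_mul_ofReal (f m) ω m).symm

theorem freqResp_apply {n : ℕ} {Ψ : ℕ → Matrix (Fin n) (Fin n) ℝ}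
    (hΨ : ∀ j k : Fin n, Summable fun h : ℕ => |Ψ h j k|) (ω : ℝ) (j k : Fin n) :
    freqResp Ψ ω j k = ∑' m : ℕ, Complex.exp (-(Complex.I * ω * m)) * (Ψ m j k : ℂ) := by
  have key : HasSum
      (fun m : ℕ => Complex.exp (-(Complex.I * ω * m)) • (Ψ m).map Complex.ofReal)
      (Matrix.of fun j k => ∑' m : ℕ, Complex.exp (-(Complex.I * ω * m)) * (Ψ m j k : ℂ)) :=
    Pi.hasSum.2 fun j => Pi.hasSum.2 fun k =>
      (summable_exp_neg_mul_ofReal (hΨ j k) ω).of_norm.hasSum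
  rw [freqResp, key.tsum_eq, Matrix.of_apply]

theorem integral_Ioo_exp_I_mul_int (z : ℤ) :
    ∫ ω in Set.Ioo (-Real.pi) Real.pi, Complex.exp (Complex.I * ω * z) =
      if z = 0 then (2 * Real.pi : ℂ) else 0 := by
  rw [← integral_Ioc_eq_integral_Ioo,
    ← intervalIntegral.integral_of_le (by linarith [Real.pi_pos])]
  split_ifs with hz
  · subst hz
    simp
    ring
  · have hc : Complex.I * (z : ℂ) ≠ 0 := mul_ne_zero Complex.I_ne_zero (by exact_mod_cast hz)
    simp_rw [mul_right_comm Complex.I _ (z : ℂ)]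
    rw [integral_exp_mul_complex hc, div_eq_zero_iff, sub_eq_zero]
    refine Or.inl (Complex.exp_eq_exp_iff_exists_int.2 ⟨z, ?_⟩)
    push_cast
    ring

/-- Cross-correlation form of Parseval's identity for two absolutely summable real sequences. -/
theorem hasSum_integral_mul_conj_mul_exp {f g : ℕ → ℝ} (hf : Summable fun m => |f m|)
    (hg : Summable fun m => |g m|) (h : ℕ) :
    HasSum (fun m : ℕ => 2 * Real.pi * ((f (m + h) : ℂ) * g m))
      (∫ ω in Set.Ioo (-Real.pi) Real.pi,
        (∑' m : ℕ, Complex.exp (-(Complex.I * ω * m)) * (f m : ℂ)) *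
          star (∑' m : ℕ, Complex.exp (-(Complex.I * ω * m)) * (g m : ℂ)) *
            Complex.exp (Complex.I * ω * h)) := by
  let F : ℕ × ℕ → ℝ → ℂ := fun p ω =>
    (f p.1 * g p.2 : ℂ) * Complex.exp (Complex.I * ω * ((h + p.2 - p.1 : ℤ) : ℂ))
  have hFnorm (p : ℕ × ℕ) (ω : ℝ) : ‖F p ω‖ = |f p.1| * |g p.2| := by
    simp only [F]
    rw [norm_mul, norm_mul, show Complex.I * ω * ((h + p.2 - p.1 : ℤ) : ℂ) =
      ((ω * (h + p.2 - p.1) : ℝ) : ℂ) * Complex.I by push_cast; ring,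
      Complex.norm_exp_ofReal_mul_I, mul_one, Complex.norm_real, Complex.norm_real,
      Real.norm_eq_abs, Real.norm_eq_abs]
  have hfg : Summable fun p : ℕ × ℕ => |f p.1| * |g p.2| :=
    hf.mul_of_nonneg hg (fun _ => abs_nonneg _) (fun _ => abs_nonneg _)
  have hFsum (ω : ℝ) : ∑' p, F p ω =
      (∑' m : ℕ, Complex.exp (-(Complex.I * ω * m)) * (f m : ℂ)) *
        star (∑' m : ℕ, Complex.exp (-(Complex.I * ω * m)) * (g m : ℂ)) *
          Complex.exp (Complex.I * ω * h) := by
    have hg' := summable_exp_neg_mul_ofReal hg ω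
    rw [tsum_star, tsum_mul_tsum_of_summable_norm (summable_exp_neg_mul_ofReal hf ω)
      (by simpa only [norm_star] using hg'), ← tsum_mul_right]
    refine tsum_congr fun p => ?_
    have hstar : star (Complex.exp (-(Complex.I * ω * p.2)) * (g p.2 : ℂ)) =
        Complex.exp (Complex.I * ω * p.2) * (g p.2 : ℂ) := by
      simp [← Complex.exp_conj]
    have hexp : Complex.exp (Complex.I * ω * ((h + p.2 - p.1 : ℤ) : ℂ)) =
        Complex.exp (-(Complex.I * ω * p.1)) * Complex.exp (Complex.I * ω * p.2) *
          Complex.exp (Complex.I * ω * h) := by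
      rw [← Complex.exp_add, ← Complex.exp_add]
      congr 1
      push_cast
      ring
    rw [hstar]
    simp only [F]
    rw [hexp]
    ring
  have hFint (p : ℕ × ℕ) : Integrable (F p) (volume.restrict (Set.Ioo (-Real.pi) Real.pi)) :=
    ((by fun_prop : Continuous (F p)).integrableOn_Icc (a := -Real.pi) (b := Real.pi)).mono_set
      Set.Ioo_subset_Icc_self
  have hmain := hasSum_integral_of_summable_integral_norm hFint (by
    simp_rw [hFnorm, integral_const]
    exact hfg.const_smul _)
  simp_rw [hFsum] at hmain
  have hinj : Function.Injective fun m : ℕ => (m + h, m) := fun a b hab => (Prod.ext_iff.1 hab).2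
  have hval (p : ℕ × ℕ) : ∫ ω in Set.Ioo (-Real.pi) Real.pi, F p ω =
      (f p.1 * g p.2 : ℂ) * if (h + p.2 - p.1 : ℤ) = 0 then (2 * Real.pi : ℂ) else 0 := by
    simp only [F]
    rw [integral_const_mul, integral_Ioo_exp_I_mul_int]
  refine ((hinj.hasSum_iff fun p hp => ?_).2 hmain).congr_fun fun m => ?_
  · rw [hval, if_neg, mul_zero]
    intro h0
    exact hp ⟨p.2, Prod.ext (by dsimp only; omega) rfl⟩
  · simp only [Function.comp_apply, hval]
    rw [if_pos (by push_cast; ring)]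
    ring

theorem continuous_tsum_exp_neg_mul_ofReal {f : ℕ → ℝ} (hf : Summable fun m => |f m|) :
    Continuous fun ω : ℝ => ∑' m : ℕ, Complex.exp (-(Complex.I * ω * m)) * (f m : ℂ) :=
  continuous_tsum (fun m => by fun_prop) hf fun m ω => (norm_exp_neg_mul_ofReal (f m) ω m).le

/-- Spectral representation of the autocovariances:
`∑_{m=0}^∞ (Ψ_{m+h} Σ Ψ_mᵀ)_{jk} = (1/(2π)) ∫_{-π}^{π} (Ψ̂(ω) Σ Ψ̂(ω)^*)_{jk} e^{iωh} dω`,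
where the complex integral on the right equals the real number on the left. -/
theorem acov_spectral_representation {n : ℕ} (hn : 1 ≤ n)
    (Ψ : ℕ → Matrix (Fin n) (Fin n) ℝ) (S : Matrix (Fin n) (Fin n) ℝ)
    (hΨ : ∀ j k : Fin n, Summable fun h : ℕ => |Ψ h j k|)
    (hsymm : S.IsSymm) (hpsd : S.PosSemidef)
    (h : ℕ) (j k : Fin n) :
    ((∑' m : ℕ, (Ψ (m + h) * S * (Ψ m)ᵀ) j k : ℝ) : ℂ) =
      (1 / (2 * Real.pi : ℂ)) *
        ∫ ω in Set.Ioo (-Real.pi) Real.pi,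
          specDens Ψ S ω j k * Complex.exp (Complex.I * ω * h) := by
  have hterm (m : ℕ) : (Ψ (m + h) * S * (Ψ m)ᵀ) j k =
      ∑ b, ∑ a, S a b * (Ψ (m + h) j a * Ψ m k b) := by
    simp only [Matrix.mul_apply, Matrix.transpose_apply, Finset.sum_mul]
    exact Finset.sum_congr rfl fun b _ => Finset.sum_congr rfl fun a _ => by ring
  have hdens (ω : ℝ) : specDens Ψ S ω j k * Complex.exp (Complex.I * ω * h) =
      ∑ b, ∑ a, (S a b : ℂ) *
        ((∑' m : ℕ, Complex.exp (-(Complex.I * ω * m)) * (Ψ m j a : ℂ)) *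
          star (∑' m : ℕ, Complex.exp (-(Complex.I * ω * m)) * (Ψ m k b : ℂ)) *
            Complex.exp (Complex.I * ω * h)) := by
    simp only [specDens, Matrix.mul_apply, Matrix.conjTranspose_apply, Matrix.map_apply,
      Finset.sum_mul, freqResp_apply hΨ]
    exact Finset.sum_congr rfl fun b _ => Finset.sum_congr rfl fun a _ => by ring
  have hint (a b : Fin n) : Integrable (fun ω : ℝ => (S a b : ℂ) *
        ((∑' m : ℕ, Complex.exp (-(Complex.I * ω * m)) * (Ψ m j a : ℂ)) *
          star (∑' m : ℕ, Complex.exp (-(Complex.I * ω * m)) * (Ψ m k b : ℂ)) *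
            Complex.exp (Complex.I * ω * h)))
      (volume.restrict (Set.Ioo (-Real.pi) Real.pi)) := by
    have hcont := (continuous_const (y := (S a b : ℂ))).mul
      (((continuous_tsum_exp_neg_mul_ofReal (hΨ j a)).mul
        (continuous_tsum_exp_neg_mul_ofReal (hΨ k b)).star).mul
          (by fun_prop : Continuous fun ω : ℝ => Complex.exp (Complex.I * ω * h)))
    exact (hcont.integrableOn_Icc (a := -Real.pi) (b := Real.pi)).mono_set
      Set.Ioo_subset_Icc_self
  simp_rw [hdens]
  rw [integral_finsetSum _ fun b _ => integrable_finsetSum _ fun a _ => hint a b]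
  simp_rw [integral_finsetSum _ fun a _ => hint a _, integral_const_mul]
  have hsum := (hasSum_sum fun b (_ : b ∈ Finset.univ) =>
    hasSum_sum fun a (_ : a ∈ Finset.univ) =>
      (hasSum_integral_mul_conj_mul_exp (hΨ j a) (hΨ k b) h).mul_left (S a b : ℂ)).mul_left
        (1 / (2 * Real.pi : ℂ))
  rw [← hsum.tsum_eq, Complex.ofReal_tsum]
  refine tsum_congr fun m => ?_
  have hpi : (Real.pi : ℂ) ≠ 0 := by exact_mod_cast Real.pi_ne_zero
  rw [hterm]
  push_cast
  simp only [Finset.mul_sum]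
  refine Finset.sum_congr rfl fun b _ => Finset.sum_congr rfl fun a _ => ?_
  field_simp
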